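/- Let T be a continuous bundle random dynamical system on E over (Ω,F,P,ϑ) with (T_ω^k)^{-1}x ≠ ∅ for all k and x ∈ X_E, and let f ∈ L^1_E(Ω,C(X)). For m ∈ ℕ_+, consider the bundle RDS T^m over (Ω,F,P,ϑ^m) with fiber maps (T^m)_ω^n = T_ω^{mn}. Then the pre-image topological pressure satisfies the power rule P_pre(T^m, S_m f) = m · P_pre(T, f). -/

import Mathlib

open MeasureTheory Filter Set

namespace PreImageRDS

variable {Ω : Type} [MeasurableSpace Ω] {X : Type} [MetricSpace X] [CompactSpace X]
  [MeasurableSpace X] [BorelSpace X]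

/-- The fiber `E_ω = {x : (ω, x) ∈ E}`. -/
def fiber (E : Set (Ω × X)) (ω : Ω) : Set X := {x | (ω, x) ∈ E}

/-- `X_E = {x : (ω, x) ∈ E for some ω}`. -/
def XE (E : Set (Ω × X)) : Set X := {x | ∃ ω, (ω, x) ∈ E}

/-- The iterates `T_ω^n = T_{ϑ^{n-1}ω} ∘ ⋯ ∘ T_{ϑω} ∘ T_ω`. -/
def Tn (ϑ : Ω → Ω) (T : Ω → X → X) : ℕ → Ω → X → X
  | 0 => fun _ x => x
  | n + 1 => fun ω x => Tn ϑ T n (ϑ ω) (T ω x)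

/-- The skew product `Θ(ω,x) = (ϑω, T_ω x)`. -/
def skew (ϑ : Ω → Ω) (T : Ω → X → X) : Ω × X → Ω × X := fun p => (ϑ p.1, T p.1 p.2)

/-- The Bowen metric `d_n^ω(y,z) = max_{0 ≤ i < n} d(T_ω^i y, T_ω^i z)`. -/
noncomputable def dn (ϑ : Ω → Ω) (T : Ω → X → X) (n : ℕ) (ω : Ω) (y z : X) : ℝ :=
  ((Finset.range n).sup fun i => nndist (Tn ϑ T i ω y) (Tn ϑ T i ω z) : NNReal)

/-- `F` is `(ω,n,ε)`-separated. -/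
def IsSep (ϑ : Ω → Ω) (T : Ω → X → X) (n : ℕ) (ε : ℝ) (ω : Ω) (F : Set X) : Prop :=
  ∀ y ∈ F, ∀ z ∈ F, y ≠ z → ε < dn ϑ T n ω y z

/-- The pre-image fiber `(T_ω^k)^{-1} x ⊆ E_ω`. -/
def preFiber (ϑ : Ω → Ω) (T : Ω → X → X) (E : Set (Ω × X)) (k : ℕ) (x : X) (ω : Ω) :
    Set X :=
  {y ∈ fiber E ω | Tn ϑ T k ω y = x}

/-- The Birkhoff sum `S_n f(ω,y) = ∑_{i<n} f(ϑ^i ω, T_ω^i y)`. -/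
noncomputable def Snf (ϑ : Ω → Ω) (T : Ω → X → X) (f : Ω → X → ℝ) (n : ℕ) (ω : Ω)
    (y : X) : ℝ :=
  ∑ i ∈ Finset.range n, f (ϑ^[i] ω) (Tn ϑ T i ω y)

/-- `P_{pre,n,ω}(T,f,ε,(T_ω^k)^{-1}x)`. -/
noncomputable def PpreN (ϑ : Ω → Ω) (T : Ω → X → X) (E : Set (Ω × X)) (f : Ω → X → ℝ)
    (n k : ℕ) (ε : ℝ) (x : X) (ω : Ω) : ℝ :=
  sSup {r : ℝ | ∃ F : Finset X, ↑F ⊆ preFiber ϑ T E k x ω ∧ IsSep ϑ T n ε ω ↑F ∧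
    r = ∑ y ∈ F, Real.exp (Snf ϑ T f n ω y)}

/-- `P_pre(T,f,ε)`. -/
noncomputable def PpreEps (P : Measure Ω) (ϑ : Ω → Ω) (T : Ω → X → X) (E : Set (Ω × X))
    (f : Ω → X → ℝ) (ε : ℝ) : ℝ :=
  limsup (fun n : ℕ => (1 / (n : ℝ)) *
    sSup {r : ℝ | ∃ k ≥ n, ∃ x ∈ XE E,
      r = ∫ ω, Real.log (PpreN ϑ T E f n k ε x ω) ∂P}) atTop

/-- The pre-image topological pressure `P_pre(T,f) = lim_{ε→0} P_pre(T,f,ε)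
    (`= sup_{ε>0} P_pre(T,f,ε)` by monotonicity in `ε`). -/
noncomputable def Ppre (P : Measure Ω) (ϑ : Ω → Ω) (T : Ω → X → X) (E : Set (Ω × X))
    (f : Ω → X → ℝ) : ℝ :=
  sSup {r : ℝ | ∃ ε > (0 : ℝ), r = PpreEps P ϑ T E f ε}

/-- The σ-algebra `F_E` (sets depending only on ω). -/
def mF (Ω X : Type) [MeasurableSpace Ω] [MeasurableSpace X] : MeasurableSpace (Ω × X) :=
  MeasurableSpace.comap Prod.fst inferInstance

/-- The σ-algebra `(F×B)^-_E = ⋂_{n ≥ 0} Θ^{-n}(F×B)_E`. -/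
def mMinus (ϑ : Ω → Ω) (T : Ω → X → X) : MeasurableSpace (Ω × X) :=
  ⨅ n : ℕ, MeasurableSpace.comap ((skew ϑ T)^[n]) inferInstance

/-- The fiberwise σ-algebra `B^-_ω = ⋂_{n ≥ 0}(T_ω^n)^{-1} B_{ϑ^n ω}`. -/
def mMinusFiber (ϑ : Ω → Ω) (T : Ω → X → X) (ω : Ω) : MeasurableSpace X :=
  ⨅ n : ℕ, MeasurableSpace.comap (Tn ϑ T n ω) inferInstance

/-- Conditional entropy `H_μ(Q | m)` of a finite family of sets given a σ-algebra `m`,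
    via conditional expectations of indicators. -/
noncomputable def condEntropyFam {α : Type} [MeasurableSpace α] (μ : Measure α)
    (m : MeasurableSpace α) {ι : Type} [Fintype ι] (Q : ι → Set α) : ℝ :=
  - ∫ a, ∑ i, ((μ[(Q i).indicator (fun _ => (1 : ℝ)) | m]) a) *
      Real.log ((μ[(Q i).indicator (fun _ => (1 : ℝ)) | m]) a) ∂μ

/-- `Q` is a finite measurable partition of `E`. -/
def IsFinPart {α : Type} [MeasurableSpace α] {ι : Type} [Fintype ι] (Q : ι → Set α)
    (E : Set α) : Prop :=
  (∀ i, MeasurableSet (Q i)) ∧ (∀ i j, i ≠ j → Disjoint (Q i) (Q j)) ∧ (⋃ i, Q i) = E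

/-- `h^{(r)}_{pre,μ}(T,Q) = lim_n (1/n) H_μ(⋁_{i<n} Θ^{-i}Q | F_E ∨ (F×B)^-_E)`. -/
noncomputable def hPrePart (ϑ : Ω → Ω) (T : Ω → X → X) (μ : Measure (Ω × X))
    {N : ℕ} (Q : Fin N → Set (Ω × X)) : ℝ :=
  limsup (fun n : ℕ => (1 / (n : ℝ)) * condEntropyFam μ (mF Ω X ⊔ mMinus ϑ T)
    (fun j : Fin n → Fin N => ⋂ i : Fin n, (skew ϑ T)^[(i : ℕ)] ⁻¹' Q (j i))) atTop

/-- The pre-image measure-theoretic entropy `h^{(r)}_{pre,μ}(T)`. -/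
noncomputable def hPre (ϑ : Ω → Ω) (T : Ω → X → X) (E : Set (Ω × X))
    (μ : Measure (Ω × X)) : ℝ :=
  sSup {h : ℝ | ∃ (N : ℕ) (Q : Fin N → Set (Ω × X)), IsFinPart Q E ∧
    h = hPrePart ϑ T μ Q}

/-- `μ ∈ M^1_P(E,T)`: a Θ-invariant probability measure on `E` with marginal `P`. -/
def IsPInv (P : Measure Ω) (ϑ : Ω → Ω) (T : Ω → X → X) (E : Set (Ω × X))
    (μ : Measure (Ω × X)) : Prop :=
  IsProbabilityMeasure μ ∧ μ E = 1 ∧ μ.map Prod.fst = P ∧ μ.map (skew ϑ T) = μ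

section Iterates

variable {Ω X : Type} {ϑ : Ω → Ω} {T : Ω → X → X}

lemma Tn_add (a b : ℕ) (ω : Ω) (x : X) :
    Tn ϑ T (a + b) ω x = Tn ϑ T b (ϑ^[a] ω) (Tn ϑ T a ω x) := by
  induction a generalizing ω x with
  | zero => simp [Tn]
  | succ a ih =>
    rw [Nat.succ_add, Function.iterate_succ_apply]
    exact ih _ _

lemma Tn_pow (m n : ℕ) (ω : Ω) (x : X) :
    Tn (ϑ^[m]) (fun ω => Tn ϑ T m ω) n ω x = Tn ϑ T (m * n) ω x := by
  induction n generalizing ω x with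
  | zero => rfl
  | succ n ih =>
    rw [Nat.mul_succ, Nat.add_comm (m * n), Tn_add (T := T)]
    exact ih _ _

lemma Snf_add (f : Ω → X → ℝ) (a b : ℕ) (ω : Ω) (y : X) :
    Snf ϑ T f (a + b) ω y = Snf ϑ T f a ω y + Snf ϑ T f b (ϑ^[a] ω) (Tn ϑ T a ω y) := by
  simp only [Snf, Finset.sum_range_add, Tn_add]
  refine congrArg _ (Finset.sum_congr rfl fun i _ => ?_)
  rw [Nat.add_comm a i, Function.iterate_add_apply]

lemma Snf_pow (f : Ω → X → ℝ) (m n : ℕ) (ω : Ω) (y : X) :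
    Snf (ϑ^[m]) (fun ω => Tn ϑ T m ω) (fun ω => Snf ϑ T f m ω) n ω y =
      Snf ϑ T f (m * n) ω y := by
  induction n with
  | zero => simp [Snf]
  | succ n ih =>
    rw [Nat.mul_succ, Snf_add (T := T), ← ih]
    simp only [Snf, Finset.sum_range_succ, Tn_pow, Function.iterate_mul]

lemma preFiber_pow (E : Set (Ω × X)) (m k : ℕ) (x : X) (ω : Ω) :
    preFiber (ϑ^[m]) (fun ω => Tn ϑ T m ω) E k x ω = preFiber ϑ T E (m * k) x ω := by
  simp only [preFiber, Tn_pow]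

variable [MetricSpace X]

lemma dn_le_iff {n : ℕ} {ω : Ω} {y z : X} {r : ℝ} (hr : 0 ≤ r) :
    dn ϑ T n ω y z ≤ r ↔ ∀ i < n, dist (Tn ϑ T i ω y) (Tn ϑ T i ω z) ≤ r := by
  lift r to NNReal using hr
  rw [dn, NNReal.coe_le_coe, Finset.sup_le_iff]
  simp only [Finset.mem_range, ← NNReal.coe_le_coe, coe_nndist]

lemma dn_self (n : ℕ) (ω : Ω) (y : X) : dn ϑ T n ω y y = 0 := by
  simp [dn]

lemma dn_nonneg (n : ℕ) (ω : Ω) (y z : X) : 0 ≤ dn ϑ T n ω y z := NNReal.coe_nonneg _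

lemma dist_Tn_le_dn {n i : ℕ} (hi : i < n) (ω : Ω) (y z : X) :
    dist (Tn ϑ T i ω y) (Tn ϑ T i ω z) ≤ dn ϑ T n ω y z :=
  (dn_le_iff (dn_nonneg n ω y z)).1 le_rfl i hi

lemma dn_mono {n n' : ℕ} (h : n ≤ n') (ω : Ω) (y z : X) :
    dn ϑ T n ω y z ≤ dn ϑ T n' ω y z :=
  (dn_le_iff (dn_nonneg n' ω y z)).2 fun _ hi => dist_Tn_le_dn (hi.trans_le h) ω y z

lemma dn_pow_le {m : ℕ} (hm : 0 < m) (n : ℕ) (ω : Ω) (y z : X) :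
    dn (ϑ^[m]) (fun ω => Tn ϑ T m ω) n ω y z ≤ dn ϑ T (m * n) ω y z := by
  refine (dn_le_iff (dn_nonneg _ ω y z)).2 fun i hi => ?_
  rw [Tn_pow, Tn_pow]
  exact dist_Tn_le_dn (Nat.mul_lt_mul_of_pos_left hi hm) ω y z

lemma dn_Tn_le_dn_add (s n : ℕ) (ω : Ω) (y z : X) :
    dn ϑ T n (ϑ^[s] ω) (Tn ϑ T s ω y) (Tn ϑ T s ω z) ≤ dn ϑ T (s + n) ω y z := by
  refine (dn_le_iff (dn_nonneg _ ω y z)).2 fun i hi => ?_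
  rw [← Tn_add, ← Tn_add]
  exact dist_Tn_le_dn (Nat.add_lt_add_left hi s) ω y z

end Iterates

section Regularity

variable {Ω X : Type} {ϑ : Ω → Ω} {T : Ω → X → X}

lemma mapsTo_Tn {K : Set X} (h : ∀ ω, MapsTo (T ω) K K) (n : ℕ) (ω : Ω) :
    MapsTo (Tn ϑ T n ω) K K := by
  induction n generalizing ω with
  | zero => exact fun _ hx => hx
  | succ n ih => exact fun x hx => ih _ (h ω hx)

lemma measurable_Tn [MeasurableSpace Ω] [MeasurableSpace X] (hϑ : Measurable ϑ)
    (hT : Measurable fun p : Ω × X => T p.1 p.2) (n : ℕ) :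
    Measurable fun p : Ω × X => Tn ϑ T n p.1 p.2 := by
  induction n with
  | zero => exact measurable_snd
  | succ n ih => exact ih.comp ((hϑ.comp measurable_fst).prodMk hT)

lemma measurable_Snf [MeasurableSpace Ω] [MeasurableSpace X] (hϑ : Measurable ϑ)
    (hT : Measurable fun p : Ω × X => T p.1 p.2)
    {f : Ω → X → ℝ} (hf : Measurable fun p : Ω × X => f p.1 p.2) (n : ℕ) :
    Measurable fun p : Ω × X => Snf ϑ T f n p.1 p.2 :=
  Finset.measurable_fun_sum _ fun i _ =>
    hf.comp (((hϑ.iterate i).comp measurable_fst).prodMk (measurable_Tn hϑ hT i))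

lemma measurable_dn [MeasurableSpace Ω] [MetricSpace X] [CompactSpace X] [MeasurableSpace X]
    [BorelSpace X] (hϑ : Measurable ϑ) (hT : Measurable fun p : Ω × X => T p.1 p.2)
    (n : ℕ) (y z : X) : Measurable fun ω => dn ϑ T n ω y z := by
  have h (i : ℕ) (y : X) : Measurable fun ω => Tn ϑ T i ω y :=
    (measurable_Tn hϑ hT i).comp measurable_prodMk_right
  unfold dn
  refine measurable_coe_nnreal_real.comp ?_
  induction n with
  | zero => simp
  | succ n ih =>
    simp only [Finset.range_add_one, Finset.sup_insert]
    exact ((h n y).nndist (h n z)).sup ih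

lemma continuousOn_Tn [MetricSpace X] {K : Set X} (hmap : ∀ ω, MapsTo (T ω) K K) {ω : Ω}
    (h : ∀ i, ContinuousOn (T (ϑ^[i] ω)) K) (n : ℕ) : ContinuousOn (Tn ϑ T n ω) K := by
  induction n generalizing ω with
  | zero => exact continuousOn_id
  | succ n ih => exact (ih fun i => h (i + 1)).comp (h 0) (hmap ω)

lemma continuousOn_Snf [MetricSpace X] {K : Set X} {f : Ω → X → ℝ}
    (hmap : ∀ ω, MapsTo (T ω) K K) {ω : Ω}
    (h : ∀ i, ContinuousOn (T (ϑ^[i] ω)) K) (hf : ∀ i, ContinuousOn (f (ϑ^[i] ω)) K) (n : ℕ) :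
    ContinuousOn (Snf ϑ T f n ω) K :=
  continuousOn_finsetSum _ fun i _ =>
    (hf i).comp (continuousOn_Tn hmap h i) (mapsTo_Tn hmap i ω)

lemma continuous_dn [MetricSpace X] {Z : Type*} [TopologicalSpace Z] {n : ℕ} {ω : Ω} {u v : Z → X}
    (hu : ∀ i, Continuous fun z => Tn ϑ T i ω (u z))
    (hv : ∀ i, Continuous fun z => Tn ϑ T i ω (v z)) :
    Continuous fun z => dn ϑ T n ω (u z) (v z) := by
  unfold dn
  exact NNReal.continuous_coe.comp
    (Continuous.finset_sup_apply fun i _ => (hu i).nndist (hv i))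

end Regularity

section Measurability

lemma nullMeasurableSet_exists_nonpos {α Z : Type*} [MeasurableSpace α] {μ : Measure α}
    [TopologicalSpace Z] [CompactSpace Z] [TopologicalSpace.SeparableSpace Z] {H : α → Z → ℝ}
    (hmeas : ∀ z, Measurable fun a => H a z) (hcont : ∀ᵐ a ∂μ, Continuous (H a)) :
    NullMeasurableSet {a | ∃ z, H a z ≤ 0} μ := by
  obtain ⟨D, hD, hDd⟩ := TopologicalSpace.exists_countable_dense Z
  have hm : MeasurableSet (⋂ l : ℕ, ⋃ z ∈ D, {a | H a z < 1 / ((l : ℝ) + 1)}) :=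
    MeasurableSet.iInter fun l => MeasurableSet.biUnion hD fun z _ =>
      measurableSet_lt (hmeas z) measurable_const
  refine hm.nullMeasurableSet.congr (eventuallyEq_set.2 ?_)
  filter_upwards [hcont] with a ha
  refine ⟨fun h => ?_, fun ⟨z, hz⟩ => ?_⟩
  · replace h : ∀ l : ℕ, ∃ z ∈ D, H a z < 1 / ((l : ℝ) + 1) := by
      simpa using h
    obtain ⟨z₀, -⟩ := h 0
    obtain ⟨z₁, -, hz₁⟩ := isCompact_univ.exists_isMinOn ⟨z₀, mem_univ _⟩ ha.continuousOn
    refine ⟨z₁, le_of_forall_pos_lt_add fun η hη => ?_⟩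
    obtain ⟨l, hl⟩ := exists_nat_one_div_lt hη
    obtain ⟨z, -, hz⟩ := h l
    rw [zero_add]
    exact (hz₁ (mem_univ z)).trans_lt (hz.trans hl)
  · refine mem_iInter.2 fun l => ?_
    have ho : IsOpen {z | H a z < 1 / ((l : ℝ) + 1)} := isOpen_lt ha continuous_const
    obtain ⟨w, hw, hwD⟩ := hDd.inter_open_nonempty _ ho
      ⟨z, hz.trans_lt (by positivity : (0 : ℝ) < 1 / ((l : ℝ) + 1))⟩
    exact mem_biUnion hwD hw

lemma nullMeasurableSet_exists_eq_zero_and_pos {α Z : Type*} [MeasurableSpace α] {μ : Measure α}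
    [TopologicalSpace Z] [CompactSpace Z] [TopologicalSpace.SeparableSpace Z] {A B : α → Z → ℝ}
    (hA : ∀ a z, 0 ≤ A a z)
    (mA : ∀ z, Measurable fun a => A a z) (mB : ∀ z, Measurable fun a => B a z)
    (cA : ∀ᵐ a ∂μ, Continuous (A a)) (cB : ∀ᵐ a ∂μ, Continuous (B a)) :
    NullMeasurableSet {a | ∃ z, A a z = 0 ∧ 0 < B a z} μ := by
  have heq : {a | ∃ z, A a z = 0 ∧ 0 < B a z} =
      ⋃ l : ℕ, {a | ∃ z, max (A a z) (1 / ((l : ℝ) + 1) - B a z) ≤ 0} := by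
    ext a
    simp only [mem_ofPred_eq, mem_iUnion, max_le_iff, sub_nonpos]
    constructor
    · rintro ⟨z, hz, hz'⟩
      obtain ⟨l, hl⟩ := exists_nat_one_div_lt hz'
      exact ⟨l, z, hz.le, hl.le⟩
    · rintro ⟨l, z, hz, hz'⟩
      exact ⟨z, hz.antisymm (hA a z), lt_of_lt_of_le (by positivity) hz'⟩
  rw [heq]
  refine NullMeasurableSet.iUnion fun l => nullMeasurableSet_exists_nonpos (fun z => ?_) ?_
  · exact (mA z).max (measurable_const.sub (mB z))
  · filter_upwards [cA, cB] with a ha hb using ha.max (continuous_const.sub hb)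

end Measurability

section Combinatorics

lemma exists_finite_code (X : Type*) [PseudoMetricSpace X] [CompactSpace X] {ε : ℝ} (hε : 0 < ε) :
    ∃ (N : ℕ) (c : X → Fin N), ∀ y z, c y = c z → dist y z ≤ ε := by
  obtain ⟨t, -, ht, hcov⟩ :=
    Metric.finite_approx_of_totallyBounded (isCompact_univ (X := X)).totallyBounded (ε / 2)
      (half_pos hε)
  have h (y : X) : ∃ a : t, dist y a < ε / 2 := by
    simpa [Metric.mem_ball] using hcov (mem_univ y)
  choose c hc using h
  have := ht.fintype
  refine ⟨Fintype.card t, fun y => Fintype.equivFin t (c y), fun y z hyz => ?_⟩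
  have hyz' : c y = c z := (Fintype.equivFin t).injective hyz
  have h1 := hc y
  have h2 := hc z
  rw [← hyz'] at h2
  linarith [dist_triangle_right y z (c y)]

lemma exists_subset_pairwise_not_rel {α : Type*} (R : α → α → Prop) (hrefl : ∀ a, R a a)
    (hsymm : ∀ a b, R a b → R b a) (w : α → ℝ) (hw : ∀ a, 0 ≤ w a) (M : ℝ) (F : Finset α)
    (hM : ∀ a ∈ F, ∀ F' ⊆ F, (∀ b ∈ F', R a b) → (F'.card : ℝ) ≤ M) :
    ∃ G ⊆ F, (∀ a ∈ G, ∀ b ∈ G, a ≠ b → ¬ R a b) ∧ ∑ a ∈ F, w a ≤ M * ∑ a ∈ G, w a := by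
  classical
  induction F using Finset.strongInduction with
  | H F ih =>
    obtain rfl | hF := F.eq_empty_or_nonempty
    · exact ⟨∅, by simp⟩
    obtain ⟨a, ha, hmax⟩ := F.exists_max_image w hF
    set F₁ := F.filter fun b => ¬ R a b with hF₁
    have hsub : F₁ ⊆ F := Finset.filter_subset _ _
    obtain ⟨G, hG, hGsep, hGsum⟩ := ih F₁
      ((Finset.ssubset_iff_of_subset hsub).2 ⟨a, ha, by simp [hF₁, hrefl]⟩)
      fun b hb F' hF' h => hM b (hsub hb) F' (hF'.trans hsub) h
    have hGR : ∀ b ∈ G, ¬ R a b := fun b hb => (Finset.mem_filter.1 (hG hb)).2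
    have haG : a ∉ G := fun h => hGR a h (hrefl a)
    refine ⟨insert a G, Finset.insert_subset ha (hG.trans hsub), ?_, ?_⟩
    · intro b hb c hc hbc
      rw [Finset.mem_insert] at hb hc
      rcases hb with rfl | hb <;> rcases hc with rfl | hc
      · exact absurd rfl hbc
      · exact hGR c hc
      · exact fun h => hGR b hb (hsymm _ _ h)
      · exact hGsep b hb c hc hbc
    · have hball : ∑ b ∈ F.filter (R a), w b ≤ M * w a := by
        calc ∑ b ∈ F.filter (R a), w b ≤ ∑ _b ∈ F.filter (R a), w a :=
              Finset.sum_le_sum fun b hb => hmax b (Finset.mem_filter.1 hb).1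
          _ = ((F.filter (R a)).card : ℝ) * w a := by rw [Finset.sum_const, nsmul_eq_mul]
          _ ≤ M * w a := mul_le_mul_of_nonneg_right
              (hM a ha _ (Finset.filter_subset _ _) fun b hb => (Finset.mem_filter.1 hb).2) (hw a)
      rw [Finset.sum_insert haG, ← Finset.sum_filter_add_sum_filter_not F (R a)]
      linarith

end Combinatorics

/-- A bundle random dynamical system with constant compact fibers `K`, together with a potential
`f` dominated by an integrable function `g` of the base point. -/
structure IsSystem {Ω X : Type} [MeasurableSpace Ω] [MetricSpace X] [MeasurableSpace X]
    (P : Measure Ω) (ϑ : Ω → Ω) (T : Ω → X → X) (E : Set (Ω × X)) (f : Ω → X → ℝ) (g : Ω → ℝ)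
    (K : Set X) : Prop where
  isComplete : P.IsComplete
  measurePreserving : MeasurePreserving ϑ P P
  isCompact : IsCompact K
  fiber_eq : ∀ ω, fiber E ω = K
  mapsTo : ∀ ω, MapsTo (T ω) K K
  measurable_map : Measurable fun p : Ω × X => T p.1 p.2
  continuousOn_map : ∀ᵐ ω ∂P, ContinuousOn (T ω) K
  nonempty_preFiber : ∀ k, ∀ x ∈ K, ∀ ω, (preFiber ϑ T E k x ω).Nonempty
  measurable_potential : Measurable fun p : Ω × X => f p.1 p.2
  continuousOn_potential : ∀ᵐ ω ∂P, ContinuousOn (f ω) K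
  abs_potential_le : ∀ ω, ∀ x ∈ K, |f ω x| ≤ g ω
  integrable_bound : Integrable g P

lemma integrable_birkhoffSum {α : Type*} [MeasurableSpace α] {μ : Measure α} {ϑ : α → α}
    (h : MeasurePreserving ϑ μ μ) {g : α → ℝ} (hg : Integrable g μ) (n : ℕ) :
    Integrable (birkhoffSum ϑ g n) μ :=
  integrable_finsetSum _ fun i _ => (h.iterate i).integrable_comp_of_integrable hg

lemma integral_comp_measurePreserving {α β : Type*} [MeasurableSpace α] [MeasurableSpace β]
    {μ : Measure α} {ν : Measure β} {φ : α → β} (h : MeasurePreserving φ μ ν) {g : β → ℝ}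
    (hg : AEStronglyMeasurable g ν) : ∫ a, g (φ a) ∂μ = ∫ b, g b ∂ν := by
  rw [← h.map_eq, integral_map h.measurable.aemeasurable (h.map_eq ▸ hg)]

lemma integral_birkhoffSum {α : Type*} [MeasurableSpace α] {μ : Measure α} {ϑ : α → α}
    (h : MeasurePreserving ϑ μ μ) {g : α → ℝ} (hg : Integrable g μ) (n : ℕ) :
    ∫ a, birkhoffSum ϑ g n a ∂μ = n * ∫ a, g a ∂μ := by
  simp only [birkhoffSum]
  rw [integral_finsetSum (f := fun i a => g (ϑ^[i] a)) _
    fun i _ => (h.iterate i).integrable_comp_of_integrable hg]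
  simp [fun i => integral_comp_measurePreserving (h.iterate i) hg.aestronglyMeasurable]

lemma card_le_of_isSep {Ω X : Type} [MetricSpace X] {ϑ : Ω → Ω} {T : Ω → X → X} {n N : ℕ} {ε : ℝ}
    (hε : 0 ≤ ε) {c : X → Fin N} (hc : ∀ y z, c y = c z → dist y z ≤ ε) {ω : Ω} {F : Finset X}
    (hF : IsSep ϑ T n ε ω ↑F) : F.card ≤ N ^ n := by
  have h := Finset.card_le_card_of_injOn (s := F) (t := Finset.univ)
    (fun y => fun i : Fin n => c (Tn ϑ T i ω y)) (fun _ _ => Finset.mem_coe.2 (Finset.mem_univ _))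
    fun y hy z hz hyz => by
      by_contra hne
      refine (hF y hy z hz hne).not_ge ((dn_le_iff hε).2 fun i hi => ?_)
      exact hc _ _ (congrFun hyz ⟨i, hi⟩)
  simpa using h

/-- The integral of `log P_{pre,n,ω}(T,f,ε,(T_ω^k)^{-1}x)`. -/
noncomputable def avgLog {Ω X : Type} [MeasurableSpace Ω] [MetricSpace X] (P : Measure Ω)
    (ϑ : Ω → Ω) (T : Ω → X → X) (E : Set (Ω × X)) (f : Ω → X → ℝ) (n k : ℕ) (ε : ℝ) (x : X) : ℝ :=
  ∫ ω, Real.log (PpreN ϑ T E f n k ε x ω) ∂P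

lemma PpreN_le {Ω X : Type} [MetricSpace X] {ϑ : Ω → Ω} {T : Ω → X → X} {E : Set (Ω × X)}
    {f : Ω → X → ℝ} {n k : ℕ} {ε : ℝ} {x : X} {ω : Ω} {C : ℝ}
    (h : ∀ F : Finset X, ↑F ⊆ preFiber ϑ T E k x ω → IsSep ϑ T n ε ω ↑F →
      ∑ y ∈ F, Real.exp (Snf ϑ T f n ω y) ≤ C) : PpreN ϑ T E f n k ε x ω ≤ C := by
  refine csSup_le ⟨0, ∅, by simp, by simp [IsSep], by simp⟩ ?_
  rintro r ⟨F, hF, hsep, rfl⟩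
  exact h F hF hsep

namespace IsSystem

variable {Ω X : Type} [MeasurableSpace Ω] [MetricSpace X] [MeasurableSpace X] {P : Measure Ω}
  {ϑ : Ω → Ω} {T : Ω → X → X} {E : Set (Ω × X)} {f : Ω → X → ℝ} {g : Ω → ℝ} {K : Set X}

lemma preFiber_subset (h : IsSystem P ϑ T E f g K) (k : ℕ) (x : X) (ω : Ω) :
    preFiber ϑ T E k x ω ⊆ K := fun _ hy => h.fiber_eq ω ▸ hy.1

lemma abs_Snf_le (h : IsSystem P ϑ T E f g K) (n : ℕ) (ω : Ω) {y : X} (hy : y ∈ K) :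
    |Snf ϑ T f n ω y| ≤ birkhoffSum ϑ g n ω :=
  (Finset.abs_sum_le_sum_abs _ _).trans
    (Finset.sum_le_sum fun i _ => h.abs_potential_le _ _ (mapsTo_Tn h.mapsTo i ω hy))

lemma ae_continuousOn_iterate (h : IsSystem P ϑ T E f g K) :
    ∀ᵐ ω ∂P, ∀ i, ContinuousOn (T (ϑ^[i] ω)) K ∧ ContinuousOn (f (ϑ^[i] ω)) K :=
  ae_all_iff.2 fun i => (h.measurePreserving.iterate i).quasiMeasurePreserving.ae
    (h.continuousOn_map.and h.continuousOn_potential)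

lemma integral_bound_nonneg (h : IsSystem P ϑ T E f g K) (hK : K.Nonempty) : 0 ≤ ∫ ω, g ω ∂P :=
  integral_nonneg fun ω => (abs_nonneg _).trans (h.abs_potential_le ω _ hK.some_mem)

lemma pow (h : IsSystem P ϑ T E f g K) (m : ℕ) :
    IsSystem P (ϑ^[m]) (fun ω => Tn ϑ T m ω) E (fun ω => Snf ϑ T f m ω) (birkhoffSum ϑ g m) K where
  isComplete := h.isComplete
  measurePreserving := h.measurePreserving.iterate m
  isCompact := h.isCompact
  fiber_eq := h.fiber_eq
  mapsTo := mapsTo_Tn h.mapsTo m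
  measurable_map := measurable_Tn h.measurePreserving.measurable h.measurable_map m
  continuousOn_map := h.ae_continuousOn_iterate.mono fun ω hω =>
    continuousOn_Tn h.mapsTo (fun i => (hω i).1) m
  nonempty_preFiber k x hx ω := by
    rw [preFiber_pow]
    exact h.nonempty_preFiber _ x hx ω
  measurable_potential :=
    measurable_Snf h.measurePreserving.measurable h.measurable_map h.measurable_potential m
  continuousOn_potential := h.ae_continuousOn_iterate.mono fun ω hω =>
    continuousOn_Snf h.mapsTo (fun i => (hω i).1) (fun i => (hω i).2) m
  abs_potential_le ω x hx := h.abs_Snf_le m ω hx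
  integrable_bound := integrable_birkhoffSum h.measurePreserving h.integrable_bound m

lemma sum_exp_le (h : IsSystem P ϑ T E f g K) {n N : ℕ} {ε : ℝ} (hε : 0 ≤ ε) {c : X → Fin N}
    (hc : ∀ y z, c y = c z → dist y z ≤ ε) {ω : Ω} {k : ℕ} {x : X} {F : Finset X}
    (hF : ↑F ⊆ preFiber ϑ T E k x ω) (hsep : IsSep ϑ T n ε ω ↑F) :
    ∑ y ∈ F, Real.exp (Snf ϑ T f n ω y) ≤ (N : ℝ) ^ n * Real.exp (birkhoffSum ϑ g n ω) := by
  calc ∑ y ∈ F, Real.exp (Snf ϑ T f n ω y)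
      ≤ ∑ _y ∈ F, Real.exp (birkhoffSum ϑ g n ω) := Finset.sum_le_sum fun y hy =>
        Real.exp_le_exp.2 ((abs_le.1 (h.abs_Snf_le n ω (h.preFiber_subset k x ω (hF hy)))).2)
    _ = (F.card : ℝ) * Real.exp (birkhoffSum ϑ g n ω) := by rw [Finset.sum_const, nsmul_eq_mul]
    _ ≤ _ := by
      gcongr
      exact_mod_cast card_le_of_isSep hε hc hsep

lemma card_le_of_dn_pow_le {m n N : ℕ} {ε δ : ℝ} (h : IsSystem P ϑ T E f g K) (hm : 0 < m)
    (hε : 0 < ε) (hδ : 0 < δ) {c : X → Fin N} (hc : ∀ y z, c y = c z → dist y z ≤ ε) {ω : Ω}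
    {J : Finset ℕ}
    (hJ : ∀ j < n, j ∉ J → ∀ y ∈ K, ∀ z ∈ K, dist y z < δ →
      dn ϑ T m (ϑ^[m * j] ω) y z ≤ ε / 2)
    {a : X} (ha : a ∈ K) {F : Finset X} (hFK : ↑F ⊆ K) (hsep : IsSep ϑ T (m * n) ε ω ↑F)
    (hF : ∀ b ∈ F, dn (ϑ^[m]) (fun ω => Tn ϑ T m ω) n ω a b ≤ δ / 2) :
    F.card ≤ N ^ (J.card * m) := by
  have hcard := Finset.card_le_card_of_injOn (s := F) (t := Finset.univ)
    (fun y => fun p : J × Fin m => c (Tn ϑ T (m * p.1 + p.2) ω y))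
    (fun _ _ => Finset.mem_coe.2 (Finset.mem_univ _))
    fun y hy z hz hyz => by
      by_contra hne
      refine (hsep y hy z hz hne).not_ge ((dn_le_iff hε.le).2 fun i hi => ?_)
      have hdiv : i / m < n := Nat.div_lt_of_lt_mul hi
      have hmod : i % m < m := Nat.mod_lt i hm
      by_cases hj : i / m ∈ J
      · have h1 := hc _ _ (congrFun hyz (⟨i / m, hj⟩, ⟨i % m, hmod⟩))
        simpa only [Nat.div_add_mod] using h1
      · have hclose (b : X) (hb : b ∈ F) : dist (Tn ϑ T i ω a) (Tn ϑ T i ω b) ≤ ε / 2 := by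
          have h1 := (dist_Tn_le_dn hdiv ω a b).trans (hF b hb)
          rw [Tn_pow, Tn_pow] at h1
          have h2 := hJ _ hdiv hj _ (mapsTo_Tn h.mapsTo _ ω ha) _
            (mapsTo_Tn h.mapsTo _ ω (hFK hb)) (h1.trans_lt (half_lt_self hδ))
          have h3 := (dist_Tn_le_dn hmod _ _ _).trans h2
          rwa [← Tn_add, ← Tn_add, Nat.div_add_mod] at h3
        linarith [hclose y hy, hclose z hz,
          dist_triangle_left (Tn ϑ T i ω y) (Tn ϑ T i ω z) (Tn ϑ T i ω a)]
  simpa using hcard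

lemma XE_eq [IsProbabilityMeasure P] (h : IsSystem P ϑ T E f g K) : XE E = K := by
  obtain ⟨ω₀⟩ := nonempty_of_isProbabilityMeasure P
  ext x
  constructor
  · rintro ⟨ω, hω⟩
    rw [← h.fiber_eq ω]
    exact hω
  · intro hx
    rw [← h.fiber_eq ω₀] at hx
    exact ⟨ω₀, hx⟩

lemma sSup_avgLog_le [IsProbabilityMeasure P] (h : IsSystem P ϑ T E f g K) (hK : K.Nonempty)
    {n : ℕ} {ε C : ℝ} (hC : ∀ k ≥ n, ∀ x ∈ K, avgLog P ϑ T E f n k ε x ≤ C) :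
    sSup {r : ℝ | ∃ k ≥ n, ∃ x ∈ XE E, r = avgLog P ϑ T E f n k ε x} ≤ C := by
  rw [h.XE_eq]
  obtain ⟨x, hx⟩ := hK
  refine csSup_le ⟨_, n, le_rfl, x, hx, rfl⟩ ?_
  rintro r ⟨k, hk, x, hx, rfl⟩
  exact hC k hk x hx

variable [CompactSpace X] {ε : ℝ}

lemma bddAbove_sums (h : IsSystem P ϑ T E f g K) (hε : 0 < ε) (n k : ℕ) (x : X) (ω : Ω) :
    BddAbove {r : ℝ | ∃ F : Finset X, ↑F ⊆ preFiber ϑ T E k x ω ∧ IsSep ϑ T n ε ω ↑F ∧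
      r = ∑ y ∈ F, Real.exp (Snf ϑ T f n ω y)} := by
  obtain ⟨N, c, hc⟩ := exists_finite_code X hε
  refine ⟨(N : ℝ) ^ n * Real.exp (birkhoffSum ϑ g n ω), ?_⟩
  rintro r ⟨F, hF, hsep, rfl⟩
  exact h.sum_exp_le hε.le hc hF hsep

lemma sum_le_PpreN (h : IsSystem P ϑ T E f g K) (hε : 0 < ε) {n k : ℕ} {x : X} {ω : Ω}
    {F : Finset X} (hF : ↑F ⊆ preFiber ϑ T E k x ω) (hsep : IsSep ϑ T n ε ω ↑F) :
    ∑ y ∈ F, Real.exp (Snf ϑ T f n ω y) ≤ PpreN ϑ T E f n k ε x ω :=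
  le_csSup (h.bddAbove_sums hε n k x ω) ⟨F, hF, hsep, rfl⟩

lemma exp_neg_le_PpreN (h : IsSystem P ϑ T E f g K) (hε : 0 < ε) (n k : ℕ) {x : X} (hx : x ∈ K)
    (ω : Ω) : Real.exp (-birkhoffSum ϑ g n ω) ≤ PpreN ϑ T E f n k ε x ω := by
  obtain ⟨y, hy⟩ := h.nonempty_preFiber k x hx ω
  have h1 := h.sum_le_PpreN hε (n := n) (F := {y}) (by simpa using hy)
    (by intro a ha b hb hab; simp_all)
  rw [Finset.sum_singleton] at h1
  refine le_trans (Real.exp_le_exp.2 ?_) h1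
  exact (abs_le.1 (h.abs_Snf_le n ω (h.preFiber_subset k x ω hy))).1

lemma PpreN_pos (h : IsSystem P ϑ T E f g K) (hε : 0 < ε) (n k : ℕ) {x : X} (hx : x ∈ K)
    (ω : Ω) : 0 < PpreN ϑ T E f n k ε x ω :=
  (Real.exp_pos _).trans_le (h.exp_neg_le_PpreN hε n k hx ω)

lemma neg_birkhoffSum_le_log (h : IsSystem P ϑ T E f g K) (hε : 0 < ε) (n k : ℕ) {x : X}
    (hx : x ∈ K) (ω : Ω) : -birkhoffSum ϑ g n ω ≤ Real.log (PpreN ϑ T E f n k ε x ω) :=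
  (Real.le_log_iff_exp_le (h.PpreN_pos hε n k hx ω)).2 (h.exp_neg_le_PpreN hε n k hx ω)

lemma log_le (h : IsSystem P ϑ T E f g K) (hε : 0 < ε) {N : ℕ} {c : X → Fin N}
    (hc : ∀ y z, c y = c z → dist y z ≤ ε) (n k : ℕ) {x : X} (hx : x ∈ K) (ω : Ω) :
    Real.log (PpreN ϑ T E f n k ε x ω) ≤ n * Real.log N + birkhoffSum ϑ g n ω := by
  have hN : (0 : ℝ) < N := by exact_mod_cast (c x).pos
  rw [← Real.log_pow, ← Real.log_exp (birkhoffSum ϑ g n ω),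
    ← Real.log_mul (pow_pos hN n).ne' (Real.exp_pos _).ne']
  exact Real.log_le_log (h.PpreN_pos hε n k hx ω)
    (PpreN_le fun F hF hsep => h.sum_exp_le hε.le hc hF hsep)

variable [BorelSpace X]

lemma measurable_PpreN (h : IsSystem P ϑ T E f g K) (hε : 0 < ε) (n k : ℕ) (x : X) :
    Measurable fun ω => PpreN ϑ T E f n k ε x ω := by
  have := h.isComplete
  have := isCompact_iff_compactSpace.1 h.isCompact
  have mϑ := h.measurePreserving.measurable
  refine measurable_of_Ioi fun r => ?_
  let A (p : ℕ) (ω : Ω) (z : Fin p → K) : ℝ := ∑ i, dist (Tn ϑ T k ω (z i)) x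
  let B (p : ℕ) (ω : Ω) (z : Fin p → K) : ℝ :=
    (∏ i, ∏ j, if i = j then 1 else max 0 (dn ϑ T n ω (z i) (z j) - ε)) *
      max 0 (∑ i, Real.exp (Snf ϑ T f n ω (z i)) - r)
  have hA (p ω z) : A p ω z = 0 ↔ ∀ i, Tn ϑ T k ω (z i) = x := by
    simp [A, Finset.sum_eq_zero_iff_of_nonneg]
  have hB (p ω z) : 0 < B p ω z ↔ (∀ i j, i ≠ j → ε < dn ϑ T n ω (z i) (z j)) ∧
      r < ∑ i, Real.exp (Snf ϑ T f n ω (z i)) := by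
    have h0 (i j : Fin p) : 0 ≤ if i = j then (1 : ℝ) else max 0 (dn ϑ T n ω (z i) (z j) - ε) := by
      split_ifs <;> simp
    have h1 : 0 ≤ ∏ i, ∏ j, if i = j then (1 : ℝ) else max 0 (dn ϑ T n ω (z i) (z j) - ε) :=
      Finset.prod_nonneg fun i _ => Finset.prod_nonneg fun j _ => h0 i j
    rw [(mul_nonneg h1 (le_max_left _ _)).lt_iff_ne', mul_ne_zero_iff]
    simp only [Finset.prod_ne_zero_iff, Finset.mem_univ, true_imp_iff]
    refine and_congr (forall₂_congr fun i j => ?_) ?_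
    · by_cases hij : i = j
      · simp [hij]
      · simp [hij]
    · simp
  have heq : (fun ω => PpreN ϑ T E f n k ε x ω) ⁻¹' Ioi r =
      ⋃ p : ℕ, {ω | ∃ z, A p ω z = 0 ∧ 0 < B p ω z} := by
    ext ω
    simp only [mem_preimage, mem_Ioi, mem_iUnion, mem_ofPred_eq, hA, hB]
    constructor
    · intro hr
      obtain ⟨F, hF, hsep, hr⟩ : ∃ F : Finset X, ↑F ⊆ preFiber ϑ T E k x ω ∧
          IsSep ϑ T n ε ω ↑F ∧ r < ∑ y ∈ F, Real.exp (Snf ϑ T f n ω y) := by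
        by_contra! hcon
        exact hr.not_ge (PpreN_le hcon)
      let e := F.equivFin
      refine ⟨F.card, fun i => ⟨(e.symm i : X), h.preFiber_subset k x ω (hF (e.symm i).2)⟩,
        fun i => (hF (e.symm i).2).2, fun i j hij => ?_, ?_⟩
      · exact hsep _ (e.symm i).2 _ (e.symm j).2 fun h => hij (e.symm.injective (Subtype.ext h))
      · rwa [Equiv.sum_comp e.symm fun y : F => Real.exp (Snf ϑ T f n ω y),
          Finset.sum_coe_sort F fun y => Real.exp (Snf ϑ T f n ω y)]
    · rintro ⟨p, z, hz, hsep, hr⟩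
      have hinj : Function.Injective fun i => (z i : X) := fun i j hij => by
        by_contra hne
        have := hsep i j hne
        simp only at hij
        rw [hij, dn_self] at this
        exact this.not_gt hε
      refine hr.trans_le ?_
      have := h.sum_le_PpreN hε (n := n) (k := k) (x := x) (ω := ω)
        (F := Finset.univ.map ⟨_, hinj⟩) ?_ ?_
      · simpa using this
      · intro y hy
        obtain ⟨i, rfl⟩ : ∃ i, (z i : X) = y := by simpa using hy
        refine ⟨?_, hz i⟩
        rw [h.fiber_eq]
        exact (z i).2
      · intro y hy y' hy' hne
        obtain ⟨i, rfl⟩ : ∃ i, (z i : X) = y := by simpa using hy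
        obtain ⟨j, rfl⟩ : ∃ i, (z i : X) = y' := by simpa using hy'
        exact hsep i j fun hij => hne (by rw [hij])
  rw [heq]
  refine MeasurableSet.iUnion fun p => NullMeasurableSet.measurable_of_complete (μ := P)
    (nullMeasurableSet_exists_eq_zero_and_pos (fun ω z => ?_) (fun z => ?_) (fun z => ?_) ?_ ?_)
  · exact Finset.sum_nonneg fun _ _ => dist_nonneg
  · exact Finset.measurable_fun_sum _ fun i _ =>
      ((measurable_Tn mϑ h.measurable_map k).comp measurable_prodMk_right).dist measurable_const
  · refine Measurable.mul (Finset.measurable_fun_prod _ fun i _ =>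
      Finset.measurable_fun_prod _ fun j _ => ?_) (measurable_const.max ?_)
    · split_ifs
      · exact measurable_const
      · exact measurable_const.max ((measurable_dn mϑ h.measurable_map n _ _).sub_const ε)
    · exact (Finset.measurable_fun_sum _ fun i _ => Real.measurable_exp.comp
        ((measurable_Snf mϑ h.measurable_map h.measurable_potential n).comp
          measurable_prodMk_right)).sub_const r
  all_goals
    filter_upwards [h.ae_continuousOn_iterate] with ω hω
    have cT (l : ℕ) (i : Fin p) : Continuous fun z : Fin p → K => Tn ϑ T l ω (z i) :=
      (continuousOn_iff_continuous_domRestrict.1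
        (continuousOn_Tn h.mapsTo (fun i => (hω i).1) l)).comp (continuous_apply i)
  · exact continuous_finsetSum _ fun i _ => (cT k i).dist continuous_const
  · refine (continuous_finsetProd _ fun i _ => continuous_finsetProd _ fun j _ => ?_).mul
      (continuous_const.max ?_)
    · split_ifs
      · exact continuous_const
      · exact continuous_const.max
          ((continuous_dn (fun l => cT l i) (fun l => cT l j)).sub continuous_const)
    · refine (continuous_finsetSum _ fun i _ => Real.continuous_exp.comp ?_).sub continuous_const
      exact (continuousOn_iff_continuous_domRestrict.1
        (continuousOn_Snf h.mapsTo (fun i => (hω i).1) (fun i => (hω i).2) n)).comp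
          (continuous_apply i)

lemma integrable_log [IsProbabilityMeasure P] (h : IsSystem P ϑ T E f g K) (hε : 0 < ε) (n k : ℕ)
    {x : X} (hx : x ∈ K) : Integrable (fun ω => Real.log (PpreN ϑ T E f n k ε x ω)) P := by
  obtain ⟨N, c, hc⟩ := exists_finite_code X hε
  have hb := integrable_birkhoffSum h.measurePreserving h.integrable_bound n
  refine integrable_of_le_of_le (h.measurable_PpreN hε n k x).log.aestronglyMeasurable
    (Eventually.of_forall fun ω => h.neg_birkhoffSum_le_log hε n k hx ω)
    (Eventually.of_forall fun ω => h.log_le hε hc n k hx ω) hb.neg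
    ((integrable_const _).add hb)

lemma neg_le_avgLog [IsProbabilityMeasure P] (h : IsSystem P ϑ T E f g K) (hε : 0 < ε) (n k : ℕ)
    {x : X} (hx : x ∈ K) : -(n * ∫ ω, g ω ∂P) ≤ avgLog P ϑ T E f n k ε x := by
  rw [← integral_birkhoffSum h.measurePreserving h.integrable_bound, ← integral_neg]
  exact integral_mono (integrable_birkhoffSum h.measurePreserving h.integrable_bound n).neg
    (h.integrable_log hε n k hx) (h.neg_birkhoffSum_le_log hε n k hx)

lemma avgLog_le_avgLog_add [IsProbabilityMeasure P] (h : IsSystem P ϑ T E f g K) {ϑ' : Ω → Ω}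
    {T' : Ω → X → X} {f' : Ω → X → ℝ} {g' : Ω → ℝ} (h' : IsSystem P ϑ' T' E f' g' K)
    {n k n' k' : ℕ} {ε' : ℝ} (hε : 0 < ε) (hε' : 0 < ε') {x : X} (hx : x ∈ K) {C : Ω → ℝ}
    (hC : Integrable C P)
    (hle : ∀ᵐ ω ∂P,
      PpreN ϑ T E f n k ε x ω ≤ Real.exp (C ω) * PpreN ϑ' T' E f' n' k' ε' x ω) :
    avgLog P ϑ T E f n k ε x ≤ avgLog P ϑ' T' E f' n' k' ε' x + ∫ ω, C ω ∂P := by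
  rw [add_comm, avgLog, avgLog, ← integral_add hC (h'.integrable_log hε' n' k' hx)]
  refine integral_mono_ae (h.integrable_log hε n k hx)
    (hC.add (h'.integrable_log hε' n' k' hx)) ?_
  filter_upwards [hle] with ω hω
  have h1 := Real.log_le_log (h.PpreN_pos hε n k hx ω) hω
  rwa [Real.log_mul (Real.exp_pos _).ne' (h'.PpreN_pos hε' n' k' hx ω).ne', Real.log_exp] at h1

lemma avgLog_le [IsProbabilityMeasure P] (h : IsSystem P ϑ T E f g K) (hε : 0 < ε) :
    ∃ C : ℝ, ∀ n k, ∀ x ∈ K, avgLog P ϑ T E f n k ε x ≤ C * n := by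
  obtain ⟨N, c, hc⟩ := exists_finite_code X hε
  refine ⟨Real.log N + ∫ ω, g ω ∂P, fun n k x hx => ?_⟩
  have hb := integrable_birkhoffSum h.measurePreserving h.integrable_bound n
  refine (integral_mono (h.integrable_log hε n k hx) ((integrable_const _).add hb)
    (h.log_le hε hc n k hx)).trans_eq ?_
  simp only [Pi.add_apply]
  rw [integral_add (integrable_const _) hb,
    integral_birkhoffSum h.measurePreserving h.integrable_bound]
  simp
  ring

lemma avgLog_pow_le [IsProbabilityMeasure P] (h : IsSystem P ϑ T E f g K) (hε : 0 < ε) {m : ℕ}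
    (hm : 0 < m) (n k : ℕ) {x : X} (hx : x ∈ K) :
    avgLog P (ϑ^[m]) (fun ω => Tn ϑ T m ω) E (fun ω => Snf ϑ T f m ω) n k ε x ≤
      avgLog P ϑ T E f (m * n) (m * k) ε x := by
  refine integral_mono ((h.pow m).integrable_log hε n k hx) (h.integrable_log hε _ _ hx)
    fun ω => Real.log_le_log ((h.pow m).PpreN_pos hε n k hx ω) (PpreN_le fun F hF hsep => ?_)
  simp only [Snf_pow]
  rw [preFiber_pow] at hF
  exact h.sum_le_PpreN hε hF fun y hy z hz hne =>
    (hsep y hy z hz hne).trans_le (dn_pow_le hm n ω y z)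

lemma avgLog_le_extend [IsProbabilityMeasure P] (h : IsSystem P ϑ T E f g K) (hε : 0 < ε)
    (n k t : ℕ) {x : X} (hx : x ∈ K) :
    avgLog P ϑ T E f n k ε x ≤ avgLog P ϑ T E f (n + t) k ε x + t * ∫ ω, g ω ∂P := by
  have hmp := h.measurePreserving.iterate n
  have hb := integrable_birkhoffSum h.measurePreserving h.integrable_bound t
  rw [← integral_birkhoffSum h.measurePreserving h.integrable_bound,
    ← integral_comp_measurePreserving hmp hb.aestronglyMeasurable]
  refine h.avgLog_le_avgLog_add h hε hε hx (hmp.integrable_comp_of_integrable hb)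
    (Eventually.of_forall fun ω => PpreN_le fun F hF hsep => ?_)
  calc ∑ y ∈ F, Real.exp (Snf ϑ T f n ω y)
      ≤ ∑ y ∈ F, Real.exp (birkhoffSum ϑ g t (ϑ^[n] ω)) *
          Real.exp (Snf ϑ T f (n + t) ω y) := Finset.sum_le_sum fun y hy => by
        have h1 := (abs_le.1 (h.abs_Snf_le t (ϑ^[n] ω)
          (mapsTo_Tn (ϑ := ϑ) h.mapsTo n ω (h.preFiber_subset k x ω (hF hy))))).1
        rw [← Real.exp_add, Snf_add]
        exact Real.exp_le_exp.2 (by linarith)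
    _ ≤ _ := by
      rw [← Finset.mul_sum]
      exact mul_le_mul_of_nonneg_left (h.sum_le_PpreN hε hF fun y hy z hz hne =>
        (hsep y hy z hz hne).trans_le (dn_mono (Nat.le_add_right n t) ω y z)) (Real.exp_pos _).le

lemma avgLog_le_shift [IsProbabilityMeasure P] (h : IsSystem P ϑ T E f g K) (hε : 0 < ε)
    (n k s : ℕ) {x : X} (hx : x ∈ K) :
    avgLog P ϑ T E f n k ε x ≤ avgLog P ϑ T E f (s + n) (s + k) ε x + s * ∫ ω, g ω ∂P := by
  classical
  have hmp := h.measurePreserving.iterate s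
  have hb := integrable_birkhoffSum h.measurePreserving h.integrable_bound s
  rw [add_comm, ← integral_birkhoffSum h.measurePreserving h.integrable_bound, avgLog,
    ← integral_comp_measurePreserving hmp (h.integrable_log hε n k hx).aestronglyMeasurable,
    avgLog, ← integral_add hb (h.integrable_log hε _ _ hx)]
  refine integral_mono (hmp.integrable_comp_of_integrable (h.integrable_log hε n k hx))
    (hb.add (h.integrable_log hε _ _ hx)) fun ω => ?_
  have hpos := h.PpreN_pos hε (s + n) (s + k) hx ω
  simp only
  rw [← Real.log_exp (birkhoffSum ϑ g s ω), ← Real.log_mul (Real.exp_pos _).ne' hpos.ne']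
  refine Real.log_le_log (h.PpreN_pos hε n k hx _) (PpreN_le fun F hF hsep => ?_)
  have hlift (y : X) : ∃ y', y ∈ K → y' ∈ K ∧ Tn ϑ T s ω y' = y := by
    by_cases hy : y ∈ K
    · obtain ⟨y', hy'⟩ := h.nonempty_preFiber s y hy ω
      exact ⟨y', fun _ => ⟨h.preFiber_subset s y ω hy', hy'.2⟩⟩
    · exact ⟨y, fun hy' => absurd hy' hy⟩
  choose l hl using hlift
  have hFK : ∀ y ∈ F, y ∈ K := fun y hy => h.preFiber_subset k x _ (hF hy)
  have hinj : Set.InjOn l F := fun y hy z hz hyz => by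
    rw [← (hl y (hFK y hy)).2, hyz, (hl z (hFK z hz)).2]
  calc ∑ y ∈ F, Real.exp (Snf ϑ T f n (ϑ^[s] ω) y)
      ≤ ∑ y ∈ F, Real.exp (birkhoffSum ϑ g s ω) *
          Real.exp (Snf ϑ T f (s + n) ω (l y)) := Finset.sum_le_sum fun y hy => by
        have hly := hl y (hFK y hy)
        have h1 := (abs_le.1 (h.abs_Snf_le s ω hly.1)).1
        rw [← Real.exp_add, Snf_add, hly.2]
        exact Real.exp_le_exp.2 (by linarith)
    _ = Real.exp (birkhoffSum ϑ g s ω) *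
          ∑ y ∈ F.image l, Real.exp (Snf ϑ T f (s + n) ω y) := by
        rw [← Finset.mul_sum, Finset.sum_image hinj]
    _ ≤ _ := by
      refine mul_le_mul_of_nonneg_left (h.sum_le_PpreN hε ?_ ?_) (Real.exp_pos _).le
      · intro y' hy'
        obtain ⟨y, hy, rfl⟩ := Finset.mem_image.1 hy'
        have hly := hl y (hFK y hy)
        refine ⟨by rw [h.fiber_eq]; exact hly.1, ?_⟩
        rw [Tn_add, hly.2]
        exact (hF hy).2
      · intro y' hy' z' hz' hne
        obtain ⟨y, hy, rfl⟩ := Finset.mem_image.1 hy'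
        obtain ⟨z, hz, rfl⟩ := Finset.mem_image.1 hz'
        have h1 := hsep y hy z hz fun hyz => hne (by rw [hyz])
        have h2 := dn_Tn_le_dn_add (ϑ := ϑ) (T := T) s n ω (l y) (l z)
        rw [(hl y (hFK y hy)).2, (hl z (hFK z hz)).2] at h2
        exact h1.trans_le h2

lemma exists_modulus [IsProbabilityMeasure P] (h : IsSystem P ϑ T E f g K) (hε : 0 < ε) (m : ℕ)
    {η : ℝ} (hη : 0 < η) :
    ∃ δ > 0, ∃ B : Set Ω, MeasurableSet B ∧ P.real B < η ∧
      ∀ᵐ ω ∂P, ω ∉ B → ∀ y ∈ K, ∀ z ∈ K, dist y z < δ → dn ϑ T m ω y z ≤ ε := by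
  have := isCompact_iff_compactSpace.1 h.isCompact
  obtain ⟨D, hD, hDd⟩ := TopologicalSpace.exists_countable_dense K
  let B (δ : ℝ) : Set Ω := {ω | ∃ y ∈ D, ∃ z ∈ D, dist y z < δ ∧ ε < dn ϑ T m ω y z}
  have hBmeas (δ : ℝ) : MeasurableSet (B δ) := by
    have : B δ = ⋃ y ∈ D, ⋃ z ∈ D, {ω | dist y z < δ ∧ ε < dn ϑ T m ω y z} := by
      ext ω
      simp only [B, mem_iUnion, mem_ofPred_eq, exists_prop]
    rw [this]
    exact MeasurableSet.biUnion hD fun y _ => MeasurableSet.biUnion hD fun z _ =>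
      (MeasurableSet.const _).inter (measurableSet_lt measurable_const
        (measurable_dn h.measurePreserving.measurable h.measurable_map m _ _))
  have hgood : ∀ᵐ ω ∂P, Continuous fun p : K × K => dn ϑ T m ω p.1 p.2 := by
    filter_upwards [h.ae_continuousOn_iterate] with ω hω
    have cT (l : ℕ) : Continuous fun z : K => Tn ϑ T l ω z :=
      continuousOn_iff_continuous_domRestrict.1
        (continuousOn_Tn h.mapsTo (fun i => (hω i).1) l)
    exact continuous_dn (fun l => (cT l).comp continuous_fst) fun l => (cT l).comp continuous_snd
  have hanti : Antitone fun l : ℕ => B (1 / ((l : ℝ) + 1)) := by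
    rintro a b hab ω ⟨y, hy, z, hz, hyz, hyz'⟩
    exact ⟨y, hy, z, hz, hyz.trans_le (one_div_le_one_div_of_le (by positivity)
      (by gcongr)), hyz'⟩
  have hnull : P (⋂ l : ℕ, B (1 / ((l : ℝ) + 1))) = 0 := by
    rw [measure_eq_zero_iff_ae_notMem]
    filter_upwards [hgood] with ω hω hmem
    have huc := CompactSpace.uniformContinuous_of_continuous hω
    obtain ⟨δ, hδ, hδ'⟩ := Metric.uniformContinuous_iff.1 huc ε hε
    obtain ⟨l, hl⟩ := exists_nat_one_div_lt hδ
    obtain ⟨y, -, z, -, hyz, hyz'⟩ := mem_iInter.1 hmem l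
    have h1 := hδ' (a := (y, z)) (b := (z, z)) (by
      simpa [Prod.dist_eq, hδ] using hyz.trans hl)
    rw [Real.dist_eq, dn_self, sub_zero, abs_of_nonneg (dn_nonneg _ _ _ _)] at h1
    exact h1.not_gt hyz'
  have hlim := tendsto_measure_iInter_atTop (μ := P)
    (fun l : ℕ => (hBmeas (1 / ((l : ℝ) + 1))).nullMeasurableSet) hanti ⟨0, measure_ne_top _ _⟩
  rw [hnull] at hlim
  obtain ⟨l, hl⟩ := (hlim.eventually (gt_mem_nhds (ENNReal.ofReal_pos.2 hη))).exists
  have hl0 : (0 : ℝ) < 1 / ((l : ℝ) + 1) := by positivity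
  refine ⟨1 / ((l : ℝ) + 1), hl0, B (1 / ((l : ℝ) + 1)), hBmeas _, ?_, ?_⟩
  · exact (ENNReal.lt_ofReal_iff_toReal_lt (measure_ne_top _ _)).1 hl
  · filter_upwards [hgood] with ω hω hmem y hy z hz hyz
    by_contra! hlt
    have ho : IsOpen {p : K × K | dist p.1 p.2 < 1 / ((l : ℝ) + 1) ∧ ε < dn ϑ T m ω p.1 p.2} :=
      (isOpen_lt (continuous_fst.dist continuous_snd) continuous_const).inter
        (isOpen_lt continuous_const hω)
    obtain ⟨⟨a, b⟩, ⟨hab, hab'⟩, ha, hb⟩ :=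
      (hDd.prod hDd).inter_open_nonempty _ ho ⟨(⟨y, hy⟩, ⟨z, hz⟩), hyz, hlt⟩
    exact hmem ⟨a, ha, b, hb, hab, hab'⟩

lemma exists_avgLog_le_pow [IsProbabilityMeasure P] (h : IsSystem P ϑ T E f g K) (hε : 0 < ε)
    {m : ℕ} (hm : 0 < m) {η : ℝ} (hη : 0 < η) :
    ∃ δ > 0, ∀ n k, ∀ x ∈ K, avgLog P ϑ T E f (m * n) (m * k) ε x ≤
      avgLog P (ϑ^[m]) (fun ω => Tn ϑ T m ω) E (fun ω => Snf ϑ T f m ω) n k δ x + η * n := by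
  classical
  obtain ⟨N, c, hc⟩ := exists_finite_code X hε
  set L : ℝ := m * Real.log N with hL
  have hL0 : 0 ≤ L := by positivity
  obtain ⟨δ, hδ, B, hB, hPB, hmod⟩ := h.exists_modulus (half_pos hε) m
    (show 0 < η / (L + 1) by positivity)
  refine ⟨δ / 2, half_pos hδ, fun n k x hx => ?_⟩
  have hmod' : ∀ᵐ ω ∂P, ∀ j, ϑ^[m * j] ω ∉ B → ∀ y ∈ K, ∀ z ∈ K, dist y z < δ →
      dn ϑ T m (ϑ^[m * j] ω) y z ≤ ε / 2 :=
    ae_all_iff.2 fun j => (h.measurePreserving.iterate (m * j)).quasiMeasurePreserving.ae hmod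
  have hN : (0 : ℝ) < N := by exact_mod_cast (c x).pos
  let b : Ω → ℝ := B.indicator fun _ => L
  have hb : Integrable b P := (integrable_const L).indicator hB
  have hmp := h.measurePreserving.iterate m
  have hint : ∫ ω, birkhoffSum (ϑ^[m]) b n ω ∂P ≤ η * n := by
    rw [integral_birkhoffSum hmp hb, integral_indicator_const _ hB, smul_eq_mul, mul_comm]
    gcongr
    rw [lt_div_iff₀ (by positivity)] at hPB
    nlinarith [measureReal_nonneg (μ := P) (s := B)]
  refine (h.avgLog_le_avgLog_add (h.pow m) (n' := n) (k' := k) hε (half_pos hδ) hx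
    (integrable_birkhoffSum hmp hb n) ?_).trans (by gcongr)
  filter_upwards [hmod'] with ω hω
  refine PpreN_le fun F hF hsep => ?_
  let J : Finset ℕ := (Finset.range n).filter fun j => ϑ^[m * j] ω ∈ B
  have hexp : Real.exp (birkhoffSum (ϑ^[m]) b n ω) = (N : ℝ) ^ (J.card * m) := by
    have h1 : birkhoffSum (ϑ^[m]) b n ω = ((J.card * m : ℕ) : ℝ) * Real.log N := by
      simp only [birkhoffSum, b, Set.indicator_apply, ← Function.iterate_mul]
      rw [← Finset.sum_filter, Finset.sum_const, nsmul_eq_mul, hL]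
      push_cast
      ring
    rw [h1, Real.exp_nat_mul, Real.exp_log hN]
  have hFK : ↑F ⊆ K := hF.trans (h.preFiber_subset _ x ω)
  obtain ⟨G, hG, hGsep, hGsum⟩ := exists_subset_pairwise_not_rel
    (fun y z => dn (ϑ^[m]) (fun ω => Tn ϑ T m ω) n ω y z ≤ δ / 2)
    (fun y => by rw [dn_self]; positivity)
    (fun y z hyz => (dn_le_iff (half_pos hδ).le).2 fun i hi => by
      rw [dist_comm]
      exact (dist_Tn_le_dn hi ω y z).trans hyz)
    (fun y => Real.exp (Snf ϑ T f (m * n) ω y)) (fun _ => (Real.exp_pos _).le)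
    ((N : ℝ) ^ (J.card * m)) F fun a ha F' hF' hR => by
      exact_mod_cast h.card_le_of_dn_pow_le hm hε hδ hc (n := n)
        (fun j hj hjJ => hω j fun hmem => hjJ (Finset.mem_filter.2 ⟨Finset.mem_range.2 hj, hmem⟩))
        (hFK ha) (fun y hy => hFK (hF' hy)) (fun y hy z hz => hsep y (hF' hy) z (hF' hz)) hR
  rw [hexp]
  refine hGsum.trans (mul_le_mul_of_nonneg_left ?_ (by positivity))
  have h2 := (h.pow m).sum_le_PpreN (half_pos hδ) (n := n) (k := k) (x := x) (ω := ω) (F := G)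
    (by rw [preFiber_pow]; exact fun y hy => hF (hG hy))
    fun y hy z hz hne => not_le.1 (hGsep y hy z hz hne)
  simpa only [Snf_pow] using h2

lemma bddAbove_avgLog [IsProbabilityMeasure P] (h : IsSystem P ϑ T E f g K) (hε : 0 < ε) (n : ℕ) :
    BddAbove {r : ℝ | ∃ k ≥ n, ∃ x ∈ XE E, r = avgLog P ϑ T E f n k ε x} := by
  obtain ⟨C, hC⟩ := h.avgLog_le hε
  refine ⟨C * n, ?_⟩
  rintro r ⟨k, -, x, hx, rfl⟩
  exact hC n k x (h.XE_eq ▸ hx)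

lemma avgLog_le_sSup [IsProbabilityMeasure P] (h : IsSystem P ϑ T E f g K) (hε : 0 < ε)
    {n k : ℕ} (hk : n ≤ k) {x : X} (hx : x ∈ K) :
    avgLog P ϑ T E f n k ε x ≤
      sSup {r : ℝ | ∃ k ≥ n, ∃ x ∈ XE E, r = avgLog P ϑ T E f n k ε x} :=
  le_csSup (h.bddAbove_avgLog hε n) ⟨k, hk, x, h.XE_eq.symm ▸ hx, rfl⟩

lemma PpreEps_le [IsProbabilityMeasure P] (h : IsSystem P ϑ T E f g K) (hK : K.Nonempty)
    (hε : 0 < ε) {c C : ℝ}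
    (hc : ∀ᶠ n : ℕ in atTop, ∀ k ≥ n, ∀ x ∈ K, avgLog P ϑ T E f n k ε x ≤ c * n + C) :
    PpreEps P ϑ T E f ε ≤ c := by
  obtain ⟨x, hx⟩ := hK
  have hlow : IsCoboundedUnder (· ≤ ·) atTop fun n : ℕ => (1 / (n : ℝ)) *
      sSup {r : ℝ | ∃ k ≥ n, ∃ x ∈ XE E, r = avgLog P ϑ T E f n k ε x} := by
    refine IsBoundedUnder.isCoboundedUnder_le
      ⟨-∫ ω, g ω ∂P, eventually_map.2 ((eventually_gt_atTop 0).mono fun n hn => ?_)⟩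
    have hn' : (0 : ℝ) < n := Nat.cast_pos.2 hn
    have h1 := (h.neg_le_avgLog hε n n hx).trans (h.avgLog_le_sSup hε le_rfl hx)
    change -∫ ω, g ω ∂P ≤ 1 / (n : ℝ) * _
    rw [one_div_mul_eq_div, le_div_iff₀ hn']
    linarith
  refine le_of_forall_pos_le_add fun η hη => limsup_le_of_le hlow ?_
  filter_upwards [hc, eventually_gt_atTop 0,
    tendsto_natCast_atTop_atTop.eventually_ge_atTop (C / η)] with n hn hn0 hnC
  have hn' : (0 : ℝ) < n := Nat.cast_pos.2 hn0
  have h1 := h.sSup_avgLog_le ⟨x, hx⟩ hn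
  rw [div_le_iff₀ hη] at hnC
  rw [one_div_mul_eq_div, div_le_iff₀ hn']
  refine h1.trans ?_
  linarith

lemma eventually_avgLog_le [IsProbabilityMeasure P] (h : IsSystem P ϑ T E f g K) (hε : 0 < ε)
    (hK : K.Nonempty) {c : ℝ} (hc : PpreEps P ϑ T E f ε < c) :
    ∀ᶠ n : ℕ in atTop, ∀ k ≥ n, ∀ x ∈ K, avgLog P ϑ T E f n k ε x ≤ c * n := by
  have hbdd : IsBoundedUnder (· ≤ ·) atTop fun n : ℕ => (1 / (n : ℝ)) *
      sSup {r : ℝ | ∃ k ≥ n, ∃ x ∈ XE E, r = avgLog P ϑ T E f n k ε x} := by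
    obtain ⟨C, hC⟩ := h.avgLog_le hε
    refine ⟨C, eventually_map.2 ((eventually_gt_atTop 0).mono fun n hn => ?_)⟩
    have hn' : (0 : ℝ) < n := Nat.cast_pos.2 hn
    change 1 / (n : ℝ) * _ ≤ C
    rw [one_div_mul_eq_div, div_le_iff₀ hn']
    exact h.sSup_avgLog_le hK fun k _ x hx => hC n k x hx
  filter_upwards [eventually_lt_of_limsup_lt hc hbdd, eventually_gt_atTop 0] with n hn hn0 k hk x hx
  refine (h.avgLog_le_sSup hε hk hx).trans ?_
  rw [one_div_mul_eq_div, div_lt_iff₀ (Nat.cast_pos.2 hn0)] at hn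
  exact hn.le

lemma PpreEps_pow_le [IsProbabilityMeasure P] (h : IsSystem P ϑ T E f g K) (hK : K.Nonempty)
    (hε : 0 < ε) {m : ℕ} (hm : 0 < m) :
    PpreEps P (ϑ^[m]) (fun ω => Tn ϑ T m ω) E (fun ω => Snf ϑ T f m ω) ε ≤
      m * PpreEps P ϑ T E f ε := by
  have hm' : (0 : ℝ) < m := Nat.cast_pos.2 hm
  refine le_of_forall_gt_imp_ge_of_dense fun c hc => ?_
  rw [← lt_div_iff₀' hm'] at hc
  refine (h.pow m).PpreEps_le hK hε (C := 0) ?_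
  filter_upwards [(tendsto_id.const_mul_atTop' hm).eventually (h.eventually_avgLog_le hε hK hc)]
    with n hn k hk x hx
  refine (h.avgLog_pow_le hε hm n k hx).trans
    ((hn (m * k) (Nat.mul_le_mul_left m hk) x hx).trans_eq ?_)
  simp only [id, Nat.cast_mul]
  field_simp
  ring

lemma exists_mul_PpreEps_le_pow [IsProbabilityMeasure P] (h : IsSystem P ϑ T E f g K)
    (hK : K.Nonempty) (hε : 0 < ε) {m : ℕ} (hm : 0 < m) {η : ℝ} (hη : 0 < η) :
    ∃ δ > 0, m * PpreEps P ϑ T E f ε ≤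
      PpreEps P (ϑ^[m]) (fun ω => Tn ϑ T m ω) E (fun ω => Snf ϑ T f m ω) δ + η := by
  have hm' : (0 : ℝ) < m := Nat.cast_pos.2 hm
  obtain ⟨δ, hδ, hle⟩ := h.exists_avgLog_le_pow hε hm hη
  refine ⟨δ, hδ, ?_⟩
  rw [← sub_le_iff_le_add]
  refine le_of_forall_gt_imp_ge_of_dense fun c hc => ?_
  rw [sub_le_iff_le_add, ← le_div_iff₀' hm']
  obtain ⟨n₀, hn₀⟩ := eventually_atTop.1 ((h.pow m).eventually_avgLog_le hδ hK hc)
  have hI := h.integral_bound_nonneg hK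
  refine h.PpreEps_le hK hε (C := 2 * |c + η| + 2 * m * ∫ ω, g ω ∂P) ?_
  filter_upwards [eventually_ge_atTop (m * n₀)] with n hn k hk x hx
  obtain ⟨s, k', hs, hk'⟩ : ∃ s k', s < m ∧ s + k = m * k' := by
    refine ⟨(m - k % m) % m, (k + (m - k % m) % m) / m, Nat.mod_lt _ hm, ?_⟩
    rw [Nat.mul_div_cancel', Nat.add_comm]
    rw [Nat.dvd_iff_mod_eq_zero, Nat.add_mod_mod, ← Nat.mod_add_mod,
      Nat.add_sub_cancel' (Nat.mod_lt k hm).le, Nat.mod_self]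
  obtain ⟨t, n', ht, hn'⟩ : ∃ t n', t < m ∧ s + n + t = m * n' := by
    refine ⟨(m - (s + n) % m) % m, (s + n + (m - (s + n) % m) % m) / m, Nat.mod_lt _ hm, ?_⟩
    rw [Nat.mul_div_cancel']
    rw [Nat.dvd_iff_mod_eq_zero, Nat.add_mod_mod, ← Nat.mod_add_mod,
      Nat.add_sub_cancel' (Nat.mod_lt _ hm).le, Nat.mod_self]
  have hn'k' : n' ≤ k' := by
    by_contra! hlt
    have := Nat.mul_le_mul_left m (Nat.succ_le_of_lt hlt)
    rw [Nat.succ_eq_add_one, Nat.mul_add] at this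
    lia
  have hn₀n' : n₀ ≤ n' := Nat.le_of_mul_le_mul_left (by lia) hm
  have h1 := h.avgLog_le_shift hε n k s hx
  have h2 := h.avgLog_le_extend hε (s + n) (s + k) t hx
  rw [hn', hk'] at h2
  rw [hk'] at h1
  have h3 := hle n' k' x hx
  have h4 := hn₀ n' hn₀n' k' hn'k' x hx
  have hs' : (s : ℝ) ≤ m := by exact_mod_cast hs.le
  have ht' : (t : ℝ) ≤ m := by exact_mod_cast ht.le
  have h5 := mul_le_mul_of_nonneg_right (add_le_add hs' ht') hI
  have hcast : (m : ℝ) * n' = s + n + t := by exact_mod_cast hn'.symm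
  have h6 : (c + η) * n' ≤ (c + η) / m * n + 2 * |c + η| := by
    have h7 : (c + η) * n' = (c + η) / m * n + (c + η) * ((s + t) / m) := by
      field_simp
      linear_combination (c + η) * hcast
    have h8 : ((s : ℝ) + t) / m ≤ 2 := by
      rw [div_le_iff₀ hm']
      linarith
    rw [h7]
    have h9 : (c + η) * ((s + t) / m) ≤ |c + η| * ((s + t) / m) :=
      mul_le_mul_of_nonneg_right (le_abs_self _) (by positivity)
    have h10 := mul_le_mul_of_nonneg_left h8 (abs_nonneg (c + η))
    linarith
  linarith

lemma Ppre_pow_of_nonempty [IsProbabilityMeasure P] (h : IsSystem P ϑ T E f g K)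
    (hK : K.Nonempty) {m : ℕ} (hm : 0 < m) :
    Ppre P (ϑ^[m]) (fun ω => Tn ϑ T m ω) E (fun ω => Snf ϑ T f m ω) = m * Ppre P ϑ T E f := by
  have hm' : (0 : ℝ) < m := Nat.cast_pos.2 hm
  by_cases hbdd : BddAbove {r : ℝ | ∃ ε > (0 : ℝ), r = PpreEps P ϑ T E f ε}
  · have hle : ∀ r ∈ {r : ℝ | ∃ ε > (0 : ℝ), r =
        PpreEps P (ϑ^[m]) (fun ω => Tn ϑ T m ω) E (fun ω => Snf ϑ T f m ω) ε},
        r ≤ m * Ppre P ϑ T E f := by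
      rintro r ⟨ε, hε, rfl⟩
      exact (h.PpreEps_pow_le hK hε hm).trans
        (mul_le_mul_of_nonneg_left (le_csSup hbdd ⟨ε, hε, rfl⟩) hm'.le)
    refine le_antisymm (csSup_le ⟨_, 1, one_pos, rfl⟩ hle) ?_
    rw [← le_div_iff₀' hm']
    refine csSup_le ⟨_, 1, one_pos, rfl⟩ ?_
    rintro r ⟨ε, hε, rfl⟩
    rw [le_div_iff₀' hm']
    refine le_of_forall_pos_le_add fun η hη => ?_
    obtain ⟨δ, hδ, hδ'⟩ := h.exists_mul_PpreEps_le_pow hK hε hm hη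
    exact hδ'.trans (add_le_add_left (le_csSup ⟨_, hle⟩ ⟨δ, hδ, rfl⟩) η)
  · have hbdd' : ¬ BddAbove {r : ℝ | ∃ ε > (0 : ℝ), r =
        PpreEps P (ϑ^[m]) (fun ω => Tn ϑ T m ω) E (fun ω => Snf ϑ T f m ω) ε} := by
      rintro ⟨C, hC⟩
      refine hbdd ⟨(C + 1) / m, ?_⟩
      rintro r ⟨ε, hε, rfl⟩
      rw [le_div_iff₀' hm']
      obtain ⟨δ, hδ, hδ'⟩ := h.exists_mul_PpreEps_le_pow hK hε hm one_pos
      exact hδ'.trans (add_le_add_left (hC ⟨δ, hδ, rfl⟩) 1)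
    rw [Ppre, Ppre, Real.sSup_of_not_bddAbove hbdd, Real.sSup_of_not_bddAbove hbdd', mul_zero]

end IsSystem

lemma Ppre_eq_zero_of_XE_eq_empty {Ω X : Type} [MeasurableSpace Ω] [MetricSpace X] {P : Measure Ω}
    {ϑ : Ω → Ω} {T : Ω → X → X} {E : Set (Ω × X)} {f : Ω → X → ℝ} (hE : XE E = ∅) :
    Ppre P ϑ T E f = 0 := by
  have h : {r : ℝ | ∃ ε > (0 : ℝ), r = PpreEps P ϑ T E f ε} = {0} := by
    ext r
    simp only [PpreEps, hE, mem_empty_iff_false, false_and, exists_false, and_false,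
      mem_ofPred_eq, mem_singleton_iff]
    simp only [ofPred_false, Real.sSup_empty, mul_zero, limsup_const]
    exact ⟨fun ⟨_, _, h⟩ => h, fun h => ⟨1, one_pos, h⟩⟩
  rw [Ppre, h, csSup_singleton]

/-- **Proposition 3.1 (power rule)**: `P_pre(T^m, S_m f) = m ⬝ P_pre(T, f)`, where `T^m`
    is the bundle RDS over `(Ω,F,P,ϑ^m)` with fiber maps `(T^m)_ω = T_ω^m`. -/
theorem Ppre_pow
    {Ω : Type} [MeasurableSpace Ω] {X : Type} [MetricSpace X] [CompactSpace X]
    [MeasurableSpace X] [BorelSpace X]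
    (P : Measure Ω) [IsProbabilityMeasure P]
    -- `F` is complete, countably generated and separates points
    (hcomplete : ∀ s t : Set Ω, MeasurableSet t → P t = 0 → s ⊆ t → MeasurableSet s)
    [MeasurableSpace.CountablyGenerated Ω]
    (hsepPts : ∀ ω₁ ω₂ : Ω, ω₁ ≠ ω₂ → ∃ s : Set Ω, MeasurableSet s ∧ ω₁ ∈ s ∧ ω₂ ∉ s)
    -- `ϑ` is an invertible `P`-preserving transformation
    (ϑ : Ω → Ω) (hϑ : MeasurePreserving ϑ P P) (hϑbij : Function.Bijective ϑ)
    -- `E` is measurable with compact fibers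
    (E : Set (Ω × X)) (hE : MeasurableSet E) (hEcomp : ∀ ω, IsCompact (fiber E ω))
    -- `T` is a continuous bundle RDS on `E`
    (T : Ω → X → X) (hTmap : ∀ ω, MapsTo (T ω) (fiber E ω) (fiber E (ϑ ω)))
    (hTmeas : Measurable fun p : Ω × X => T p.1 p.2)
    (hTcont : ∀ᵐ ω ∂P, ContinuousOn (T ω) (fiber E ω))
    -- nonempty pre-image fibers
    (hfib : ∀ k : ℕ, ∀ x ∈ XE E, ∀ ω : Ω, (preFiber ϑ T E k x ω).Nonempty)
    -- `f ∈ L¹_E(Ω, C(X))`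
    (f : Ω → X → ℝ) (hfmeas : Measurable fun p : Ω × X => f p.1 p.2)
    (hfcont : ∀ ω, ContinuousOn (f ω) (fiber E ω))
    (hfint : Integrable (fun ω => sSup ((fun x => |f ω x|) '' fiber E ω)) P)
    (m : ℕ) (hm : 0 < m) :
    Ppre P (ϑ^[m]) (fun ω => Tn ϑ T m ω) E (fun ω => Snf ϑ T f m ω)
      = m * Ppre P ϑ T E f := by
  have hfiber (ω : Ω) : fiber E ω = XE E := by
    refine Subset.antisymm (fun x hx => ⟨ω, hx⟩) fun x hx => ?_
    obtain ⟨y, hy, rfl⟩ := hfib 0 x hx ω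
    exact hy
  rcases (XE E).eq_empty_or_nonempty with hempty | hne
  · rw [Ppre_eq_zero_of_XE_eq_empty hempty, Ppre_eq_zero_of_XE_eq_empty hempty, mul_zero]
  obtain ⟨ω₀⟩ := nonempty_of_isProbabilityMeasure P
  have hsys : IsSystem P ϑ T E f (fun ω => sSup ((fun x => |f ω x|) '' fiber E ω)) (XE E) :=
    { isComplete := ⟨fun s hs => hcomplete s _ (measurableSet_toMeasurable P s)
        ((measure_toMeasurable s).trans hs) (subset_toMeasurable P s)⟩
      measurePreserving := hϑ
      isCompact := hfiber ω₀ ▸ hEcomp ω₀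
      fiber_eq := hfiber
      mapsTo := fun ω => by simpa only [hfiber] using hTmap ω
      measurable_map := hTmeas
      continuousOn_map := by simpa only [hfiber] using hTcont
      nonempty_preFiber := hfib
      measurable_potential := hfmeas
      continuousOn_potential := Eventually.of_forall fun ω => hfiber ω ▸ hfcont ω
      abs_potential_le := fun ω x hx =>
        le_csSup ((hEcomp ω).image_of_continuousOn (hfcont ω).abs).bddAbove
          ⟨x, by rwa [hfiber], rfl⟩
      integrable_bound := hfint }
  exact hsys.Ppre_pow_of_nonempty hne hm

end PreImageRDS
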